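/- Define U : ℕ × ℕ → ℤ by U(i,j) = 1 if C(j,i) is odd and 0 otherwise. Suppose 2^{k−1} < n ≤ 2^k and 2^{k−1} ≤ m < 2^k. Then for all i with m+n−2^k ≤ i < n and all j with 2^k ≤ j < m+n, U(i,j) = 0; i.e., the bottom-right block of the submatrix (U(i, m+j))_{0≤i,j<n} (rows indexed by [m+n−2^k, n), columns by original indices [2^k, m+n)) is zero. -/

import Mathlib

def U (i j : ℕ) : ℤ := if Odd (Nat.choose j i) then 1 else 0

/-- If `r < i < p ^ k`, then adding `i` and `p ^ k + r - i` in base `p` produces a carry, so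
`p` divides `(p ^ k + r).choose i`. -/
theorem prime_dvd_choose_pow_add {p k r i : ℕ} (hp : p.Prime) (hr : r < i) (hi : i < p ^ k) :
    p ∣ (p ^ k + r).choose i := by
  rw [Nat.add_choose_eq]
  refine Finset.dvd_sum fun x hx => ?_
  have hsum : x.1 + x.2 = i := Finset.HasAntidiagonal.mem_antidiagonal.mp hx
  by_cases h : x.1 = 0
  · rw [Nat.choose_eq_zero_of_lt (show r < x.2 by omega), mul_zero]
    exact dvd_zero p
  · exact (hp.dvd_choose_pow h (by omega)).mul_right _

theorem bottom_right_block_zero (k n m : ℕ) (hk : 1 ≤ k)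
    (hn1 : 2 ^ (k - 1) < n) (hn2 : n ≤ 2 ^ k)
    (hm1 : 2 ^ (k - 1) ≤ m) (hm2 : m < 2 ^ k)
    (i j : ℕ) (hi1 : m + n - 2 ^ k ≤ i) (hi2 : i < n)
    (hj1 : 2 ^ k ≤ j) (hj2 : j < m + n) :
    U i j = 0 := by
  obtain ⟨r, rfl⟩ := Nat.exists_eq_add_of_le hj1
  have h : 2 ∣ (2 ^ k + r).choose i :=
    prime_dvd_choose_pow_add Nat.prime_two (by omega) (by omega)
  exact if_neg (Nat.not_odd_iff_even.mpr (even_iff_two_dvd.mpr h))
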